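/- For every integer n > 1, ospt(n) ≤ p(n)/2 − M(0,n)/2, where M(0,n) is the number of partitions of n with crank 0. -/

import Mathlib

open scoped BigOperators

namespace RankCrank

/-- The `i`-th largest part of a partition (1-indexed); `0` if `i` exceeds
the number of parts. -/
def part {n : ℕ} (l : n.Partition) (i : ℕ) : ℕ :=
  ((l.parts.sort (· ≤ ·)).reverse).getD (i - 1) 0

/-- The rank of a partition: largest part minus number of parts. -/
def rank {n : ℕ} (l : n.Partition) : ℤ :=
  (part l 1 : ℤ) - l.parts.card

/-- The crank of a partition: the largest part if there are no parts equal to 1,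
otherwise the number of parts larger than the number of 1's minus the number of 1's. -/
def crank {n : ℕ} (l : n.Partition) : ℤ :=
  if l.parts.count 1 = 0 then (part l 1 : ℤ)
  else ((l.parts.filter (fun x => l.parts.count 1 < x)).card : ℤ) - l.parts.count 1

/-- `N m n` is the number of partitions of `n` with rank `m`. -/
noncomputable def N (m : ℤ) (n : ℕ) : ℕ :=
  Nat.card {l : n.Partition // rank l = m}

/-- `M m n` is the number of partitions of `n` with crank `m` for `n ≠ 1`, with the
usual convention for `n = 1`. -/
noncomputable def M (m : ℤ) (n : ℕ) : ℤ :=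
  if n = 1 then (if m = 0 then -1 else if m = 1 ∨ m = -1 then 1 else 0)
  else (Nat.card {l : n.Partition // crank l = m} : ℤ)

/-- `Nle m n = N(≤ m, n) = ∑_{r ≤ m} N(r,n)`; since `N(r,n) = 0` for `r < -n`,
the sum may be taken over `-n ≤ r ≤ m`. -/
noncomputable def Nle (m : ℤ) (n : ℕ) : ℤ :=
  ∑ r ∈ Finset.Icc (-(n : ℤ)) m, (N r n : ℤ)

/-- `Mle m n = M(≤ m, n) = ∑_{r ≤ m} M(r,n)`; since `M(r,n) = 0` for `r < -n`,
the sum may be taken over `-n ≤ r ≤ m`. -/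
noncomputable def Mle (m : ℤ) (n : ℕ) : ℤ :=
  ∑ r ∈ Finset.Icc (-(n : ℤ)) m, M r n

/-- The number of partitions of `n`. -/
noncomputable def p (n : ℕ) : ℕ := Nat.card n.Partition

/-- `ospt n = ∑_{m ≥ 0} m M(m,n) - ∑_{m ≥ 0} m N(m,n)`; since ranks and cranks of
partitions of `n` are at most `n`, the sums may be taken over `0 ≤ m ≤ n`. -/
noncomputable def ospt (n : ℕ) : ℤ :=
  (∑ m ∈ Finset.Icc (0 : ℤ) (n : ℤ), m * M m n) -
    (∑ m ∈ Finset.Icc (0 : ℤ) (n : ℤ), m * (N m n : ℤ))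

/-- The rank-set of a partition `λ`:  `{j - λ_{j+1} : 0 ≤ j ≤ ℓ-1} ∪ {j : j ≥ ℓ}`
(note `part l (j+1) = 0` for `j ≥ ℓ`). -/
def rankSet {n : ℕ} (l : n.Partition) : Set ℤ :=
  {x | ∃ j : ℕ, x = (j : ℤ) - (part l (j + 1) : ℤ)}

/-- `q m n` is the number of partitions of `n` whose rank-set contains `m`. -/
noncomputable def q (m : ℤ) (n : ℕ) : ℕ :=
  Nat.card {l : n.Partition // m ∈ rankSet l}

/-- `prank m n` is the number of partitions of `n` with rank at least `m`. -/
noncomputable def prank (m : ℤ) (n : ℕ) : ℕ :=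
  Nat.card {l : n.Partition // m ≤ rank l}

/-- `jm m l` is the number of columns of the `m`-Durfee rectangle of `l`: the largest
`j ≥ 0` with `λ_{m+j} ≥ j`. -/
noncomputable def jm {n : ℕ} (m : ℕ) (l : n.Partition) : ℕ :=
  sSup {j : ℕ | j ≤ part l (m + j)}

/-- The total number of smallest parts in all partitions of `n`. -/
def spt (n : ℕ) : ℕ :=
  ∑ l : n.Partition, l.parts.count ((l.parts.sort (· ≤ ·)).headD 0)

/-- A bijection `τ` on partitions of `n` nearly preserves the rank–crank
distribution if `crank λ - rank (τ λ)` is `0` when `crank λ = 0`, is `0` or `1`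
when `crank λ > 0`, and is `0` or `-1` when `crank λ < 0`. -/
def NearlyPreserves {n : ℕ} (τ : n.Partition ≃ n.Partition) : Prop :=
  ∀ l : n.Partition,
    (crank l = 0 → crank l - rank (τ l) = 0) ∧
    (0 < crank l → crank l - rank (τ l) = 0 ∨ crank l - rank (τ l) = 1) ∧
    (crank l < 0 → crank l - rank (τ l) = 0 ∨ crank l - rank (τ l) = -1)

end RankCrank

namespace RankCrank

/-- The number of elements of `s` exceeding `k`. For a multiset of positive parts this is the
`k`-th part (counted from zero) of the conjugate partition. -/
def numGt (s : Multiset ℕ) (k : ℕ) : ℕ := s.countP (k < ·)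

lemma numGt_cons (a : ℕ) (s : Multiset ℕ) (k : ℕ) :
    numGt (a ::ₘ s) k = numGt s k + if k < a then 1 else 0 :=
  Multiset.countP_cons _ _ _

lemma numGt_add (s t : Multiset ℕ) (k : ℕ) : numGt (s + t) k = numGt s k + numGt t k :=
  Multiset.countP_add _ _ _

lemma numGt_le_card (s : Multiset ℕ) (k : ℕ) : numGt s k ≤ s.card := Multiset.countP_le_card _ _

lemma numGt_antitone (s : Multiset ℕ) : Antitone (numGt s) := fun i j h => by
  unfold numGt
  simp only [Multiset.countP_eq_card_filter]
  exact Multiset.card_le_card (Multiset.monotone_filter_right s fun x hx => lt_of_le_of_lt h hx)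

lemma count_add_numGt (s : Multiset ℕ) (k : ℕ) :
    s.count (k + 1) + numGt s (k + 1) = numGt s k := by
  induction s using Multiset.induction_on with
  | empty => simp [numGt]
  | cons a s ih =>
    rw [numGt_cons, numGt_cons, Multiset.count_cons, ← ih]
    split_ifs <;> omega

lemma mem_of_numGt_lt {s : Multiset ℕ} {k : ℕ} (h : numGt s (k + 1) < numGt s k) :
    k + 1 ∈ s := by
  have := count_add_numGt s k
  exact Multiset.count_pos.1 (by omega)

lemma numGt_pos_iff {s : Multiset ℕ} {k : ℕ} : 0 < numGt s k ↔ ∃ x ∈ s, k < x :=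
  Multiset.countP_pos

lemma numGt_zero {s : Multiset ℕ} (hs : 0 ∉ s) : numGt s 0 = s.card := by
  refine Multiset.countP_eq_card.2 fun x hx => Nat.pos_of_ne_zero ?_
  rintro rfl
  exact hs hx

lemma sup_le_iff_numGt {s : Multiset ℕ} {k : ℕ} : s.sup ≤ k ↔ numGt s k = 0 := by
  rw [Multiset.sup_le, ← not_iff_not, ← ne_eq (numGt s k), ← Nat.pos_iff_ne_zero, numGt_pos_iff]
  push Not
  rfl

lemma eq_of_numGt_eq {s t : Multiset ℕ} (hs : 0 ∉ s) (ht : 0 ∉ t)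
    (h : ∀ k, numGt s k = numGt t k) : s = t := by
  ext x
  rcases x with _ | x
  · rw [Multiset.count_eq_zero.2 hs, Multiset.count_eq_zero.2 ht]
  · have h₁ := count_add_numGt s x
    have h₂ := count_add_numGt t x
    have h₃ := h x
    have h₄ := h (x + 1)
    omega

lemma sum_numGt {s : Multiset ℕ} {n : ℕ} (h : ∀ x ∈ s, x ≤ n) :
    ∑ k ∈ Finset.range n, numGt s k = s.sum := by
  induction s using Multiset.induction_on with
  | empty => simp [numGt]
  | cons a s ih =>
    simp only [numGt_cons, Finset.sum_add_distrib, Multiset.sum_cons]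
    rw [ih fun x hx => h x (Multiset.mem_cons_of_mem hx), ← Finset.sum_filter]
    have ha := h a (Multiset.mem_cons_self a s)
    have : Finset.filter (fun k => k < a) (Finset.range n) = Finset.range a := by
      ext k
      simp only [Finset.mem_filter, Finset.mem_range]
      omega
    rw [this]
    simp
    omega

/-- The conjugate partition. -/
def conj (s : Multiset ℕ) : Multiset ℕ :=
  ((Multiset.range s.sum).map (numGt s)).filter (0 < ·)

lemma zero_notMem_conj (s : Multiset ℕ) : 0 ∉ conj s := by simp [conj]

lemma lt_numGt_conj {s : Multiset ℕ} {i j : ℕ} : i < numGt (conj s) j ↔ j < numGt s i := by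
  have h₁ : numGt (conj s) j
      = (Finset.filter (fun k => j < numGt s k) (Finset.range s.sum)).card := by
    unfold conj
    rw [numGt, Multiset.countP_filter, Multiset.countP_map]
    simp only [Finset.card_def, Finset.filter_val, Finset.range_val]
    congr 1
    refine Multiset.filter_congr fun x _ => ?_
    omega
  rw [h₁]
  constructor
  · intro h
    by_contra hj
    have hsub : Finset.filter (fun k => j < numGt s k) (Finset.range s.sum) ⊆ Finset.range i := by
      intro k hk
      simp only [Finset.mem_filter, Finset.mem_range] at hk ⊢
      by_contra hki
      have := numGt_antitone s (not_lt.1 hki)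
      omega
    have := Finset.card_le_card hsub
    rw [Finset.card_range] at this
    omega
  · intro h
    obtain ⟨x, hx, hix⟩ := numGt_pos_iff.1 (lt_of_le_of_lt (Nat.zero_le j) h)
    have hxs := Multiset.le_sum_of_mem hx
    have hsub : Finset.range (i + 1) ⊆
        Finset.filter (fun k => j < numGt s k) (Finset.range s.sum) := by
      intro k hk
      simp only [Finset.mem_filter, Finset.mem_range] at hk ⊢
      have := numGt_antitone s (Nat.lt_succ_iff.1 hk)
      omega
    have := Finset.card_le_card hsub
    rw [Finset.card_range] at this
    omega

lemma conj_conj {s : Multiset ℕ} (hs : 0 ∉ s) : conj (conj s) = s := by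
  refine eq_of_numGt_eq (zero_notMem_conj _) hs fun k => ?_
  refine eq_of_forall_lt_iff fun i => ?_
  rw [lt_numGt_conj, lt_numGt_conj]

lemma sum_conj (s : Multiset ℕ) : (conj s).sum = s.sum := by
  rw [← sum_numGt (s := s) (n := s.sum) fun x hx => Multiset.le_sum_of_mem hx]
  have h : ∀ t : Multiset ℕ, (t.filter (0 < ·)).sum = t.sum := by
    intro t
    induction t using Multiset.induction_on with
    | empty => simp
    | cons a t ih =>
      rcases Nat.eq_zero_or_pos a with rfl | ha
      · simp [ih]
      · simp [ha, ih]
  rw [conj, h]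
  rfl

lemma sup_conj {s : Multiset ℕ} (hs : 0 ∉ s) : (conj s).sup = s.card := by
  refine eq_of_forall_ge_iff fun k => ?_
  rw [sup_le_iff_numGt, ← numGt_zero hs, ← not_lt, ← not_iff_not, not_not, ← lt_numGt_conj (i := 0)]
  omega

lemma card_conj {s : Multiset ℕ} (hs : 0 ∉ s) : (conj s).card = s.sup := by
  rw [← sup_conj (zero_notMem_conj s), conj_conj hs]

/-- The side of the `c`-Durfee rectangle: the least `k` such that at most `k + c` parts
exceed `k`. -/
noncomputable def durfee (c : ℕ) (s : Multiset ℕ) : ℕ := sInf {k | numGt s k ≤ k + c}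

lemma durfee_le_iff {c k : ℕ} {s : Multiset ℕ} : durfee c s ≤ k ↔ numGt s k ≤ k + c := by
  have hne : {k | numGt s k ≤ k + c}.Nonempty :=
    ⟨s.card, (numGt_le_card s _).trans (Nat.le_add_right _ _)⟩
  refine ⟨fun h => ?_, fun h => Nat.sInf_le h⟩
  have h₁ : numGt s (durfee c s) ≤ durfee c s + c := Nat.sInf_mem hne
  have h₂ := numGt_antitone s h
  omega

lemma numGt_durfee_le (c : ℕ) (s : Multiset ℕ) :
    numGt s (durfee c s) ≤ durfee c s + c := durfee_le_iff.1 le_rfl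

lemma lt_numGt_of_lt_durfee {c k : ℕ} {s : Multiset ℕ} (h : k < durfee c s) :
    k + c < numGt s k := not_le.1 fun h' => absurd (durfee_le_iff.2 h') (not_le.2 h)

lemma durfee_eq {c k : ℕ} {s : Multiset ℕ} (h₁ : numGt s k ≤ k + c)
    (h₂ : ∀ j, k = j + 1 → j + c < numGt s j) : durfee c s = k := by
  refine le_antisymm (durfee_le_iff.2 h₁) ?_
  rcases k with _ | j
  · exact Nat.zero_le _
  · by_contra h
    have := durfee_le_iff.1 (Nat.lt_succ_iff.1 (not_le.1 h))
    have := h₂ j rfl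
    omega

lemma durfee_conj_le_iff {c k : ℕ} {s : Multiset ℕ} :
    durfee c (conj s) ≤ k ↔ numGt s (k + c) ≤ k := by
  rw [durfee_le_iff, ← not_lt, lt_numGt_conj, not_lt]

lemma numGt_durfee_conj_le (c : ℕ) (s : Multiset ℕ) :
    numGt s (durfee c (conj s) + c) ≤ durfee c (conj s) := durfee_conj_le_iff.1 le_rfl

lemma lt_numGt_of_lt_durfee_conj {c k : ℕ} {s : Multiset ℕ} (h : k < durfee c (conj s)) :
    k < numGt s (k + c) := not_le.1 fun h' => absurd (durfee_conj_le_iff.2 h') (not_le.2 h)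

lemma durfee_conj_eq {c k : ℕ} {s : Multiset ℕ} (h₁ : numGt s (k + c) ≤ k)
    (h₂ : ∀ j, k = j + 1 → j < numGt s (j + c)) : durfee c (conj s) = k := by
  refine le_antisymm (durfee_conj_le_iff.2 h₁) ?_
  rcases k with _ | j
  · exact Nat.zero_le _
  · by_contra h
    have := durfee_conj_le_iff.1 (Nat.lt_succ_iff.1 (not_le.1 h))
    have := h₂ j rfl
    omega

lemma ncard_eq_of_inverse {α β : Type*} {s : Set α} {t : Set β} (f : α → β) (g : β → α)
    (hf : ∀ a ∈ s, f a ∈ t ∧ g (f a) = a) (hg : ∀ b ∈ t, g b ∈ s ∧ f (g b) = b) :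
    s.ncard = t.ncard :=
  Set.ncard_congr (fun a _ => f a) (fun a ha => (hf a ha).1)
    (fun a b ha hb h => by rw [← (hf a ha).2, ← (hf b hb).2, h])
    (fun b hb => ⟨g b, (hg b hb).1, (hg b hb).2⟩)

lemma finite_sum_le (n : ℕ) : {s : Multiset ℕ | 0 ∉ s ∧ s.sum ≤ n}.Finite := by
  refine Set.Finite.subset (Set.finite_iUnion fun m : Fin (n + 1) =>
    Set.finite_range fun l : (m : ℕ).Partition => l.parts) ?_
  rintro s ⟨hs, hn⟩
  refine Set.mem_iUnion.2 ⟨⟨s.sum, Nat.lt_succ_of_le hn⟩, ⟨s, fun {i} hi => ?_, rfl⟩, rfl⟩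
  exact Nat.pos_of_ne_zero fun h => hs (h ▸ hi)

lemma finite_of_sum_le {S : Set (Multiset ℕ)} (x : ℤ)
    (h : ∀ s ∈ S, 0 ∉ s ∧ (s.sum : ℤ) ≤ x) : S.Finite :=
  (finite_sum_le x.toNat).subset fun s hs => ⟨(h s hs).1, by have := (h s hs).2; omega⟩

/-- The number of partitions of the integer `x` (zero if `x` is negative). -/
noncomputable def pInt (x : ℤ) : ℤ :=
  {s : Multiset ℕ | 0 ∉ s ∧ (s.sum : ℤ) = x}.ncard

/-- The number of partitions `s` with `|s| + durfee c s = x`. -/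
noncomputable def durfeeCount (c : ℕ) (x : ℤ) : ℤ :=
  {s : Multiset ℕ | 0 ∉ s ∧ (s.sum : ℤ) + durfee c s = x}.ncard

/-- The number of partitions of `x` with rank at least `m`. -/
noncomputable def rankGe (m : ℕ) (x : ℤ) : ℤ :=
  {s : Multiset ℕ | 0 ∉ s ∧ (s.sum : ℤ) = x ∧ s.card + m ≤ s.sup}.ncard

lemma ncard_setOf_conj (Q : Multiset ℕ → Prop) :
    {s : Multiset ℕ | 0 ∉ s ∧ Q (conj s)}.ncard = {s : Multiset ℕ | 0 ∉ s ∧ Q s}.ncard := by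
  refine ncard_eq_of_inverse conj conj ?_ ?_
  · rintro s ⟨hs, h⟩
    exact ⟨⟨zero_notMem_conj s, h⟩, conj_conj hs⟩
  · rintro s ⟨hs, h⟩
    refine ⟨⟨zero_notMem_conj s, ?_⟩, conj_conj hs⟩
    rwa [conj_conj hs]

lemma durfeeCount_conj (c : ℕ) (x : ℤ) : durfeeCount c x =
    {s : Multiset ℕ | 0 ∉ s ∧ (s.sum : ℤ) + durfee c (conj s) = x}.ncard := by
  rw [durfeeCount, ← ncard_setOf_conj fun s => (s.sum : ℤ) + durfee c s = x]
  simp only [sum_conj]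

/-- Adjoin a part `a` to `s`, doing nothing if `a = 0`. -/
def addPart (a : ℕ) (s : Multiset ℕ) : Multiset ℕ := if a = 0 then s else a ::ₘ s

lemma zero_notMem_addPart {a : ℕ} {s : Multiset ℕ} (hs : 0 ∉ s) : 0 ∉ addPart a s := by
  unfold addPart
  split_ifs with h
  · exact hs
  · simp [hs, Ne.symm h]

lemma sum_addPart (a : ℕ) (s : Multiset ℕ) : (addPart a s).sum = a + s.sum := by
  unfold addPart
  split_ifs with h <;> simp [h]

lemma numGt_addPart (a : ℕ) (s : Multiset ℕ) (k : ℕ) :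
    numGt (addPart a s) k = numGt s k + if k < a then 1 else 0 := by
  unfold addPart
  split_ifs with h h'
  · omega
  · rfl
  · rw [numGt_cons, if_pos ‹_›]
  · rw [numGt_cons, if_neg ‹_›]

lemma addPart_erase {a : ℕ} {s : Multiset ℕ} (hs : 0 ∉ s) (h : a ≠ 0 → a ∈ s) :
    addPart a (s.erase a) = s := by
  unfold addPart
  split_ifs with h'
  · rw [h', Multiset.erase_of_notMem hs]
  · exact Multiset.cons_erase (h h')

lemma erase_addPart {a : ℕ} {s : Multiset ℕ} (hs : 0 ∉ s) :
    (addPart a s).erase a = s := by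
  unfold addPart
  split_ifs with h'
  · rw [h', Multiset.erase_of_notMem hs]
  · exact Multiset.erase_cons_head _ _

lemma zero_notMem_erase {a : ℕ} {s : Multiset ℕ} (hs : 0 ∉ s) : 0 ∉ s.erase a :=
  fun h => hs (Multiset.mem_of_mem_erase h)

lemma durfee_addPart (c : ℕ) (s : Multiset ℕ) :
    durfee (c + 1) (addPart (durfee c s) s) = durfee c s := by
  refine durfee_eq ?_ fun j hj => ?_
  · rw [numGt_addPart, if_neg (lt_irrefl _)]
    have := numGt_durfee_le c s
    omega
  · have := lt_numGt_of_lt_durfee (c := c) (s := s) (k := j) (by omega)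
    rw [numGt_addPart, if_pos (by omega)]
    omega

lemma durfee_mem {c : ℕ} {s : Multiset ℕ}
    (h : numGt s (durfee (c + 1) s) ≤ durfee (c + 1) s + c) (h₀ : durfee (c + 1) s ≠ 0) :
    durfee (c + 1) s ∈ s := by
  obtain ⟨j, hj⟩ := Nat.exists_eq_add_one_of_ne_zero h₀
  have := lt_numGt_of_lt_durfee (c := c + 1) (s := s) (k := j) (by omega)
  rw [hj] at h ⊢
  exact mem_of_numGt_lt (by omega)

lemma durfee_erase {c : ℕ} {s : Multiset ℕ} (hs : 0 ∉ s)
    (h : numGt s (durfee (c + 1) s) ≤ durfee (c + 1) s + c) :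
    durfee c (s.erase (durfee (c + 1) s)) = durfee (c + 1) s := by
  have hg := numGt_addPart (durfee (c + 1) s) (s.erase (durfee (c + 1) s))
  rw [addPart_erase hs (durfee_mem h)] at hg
  refine durfee_eq ?_ fun j hj => ?_
  · have := hg (durfee (c + 1) s)
    rw [if_neg (lt_irrefl _)] at this
    omega
  · have := lt_numGt_of_lt_durfee (c := c + 1) (s := s) (k := j) (by omega)
    have h' := hg j
    rw [if_pos (by omega)] at h'
    omega

lemma durfeeCount_eq_ncard (c : ℕ) (x : ℤ) : durfeeCount c x =
    {s : Multiset ℕ | 0 ∉ s ∧ (s.sum : ℤ) = x ∧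
      numGt s (durfee (c + 1) s) ≤ durfee (c + 1) s + c}.ncard := by
  rw [durfeeCount, ncard_eq_of_inverse (fun s => addPart (durfee c s) s)
    (fun s => s.erase (durfee (c + 1) s))]
  · rintro s ⟨hs, h⟩
    refine ⟨⟨zero_notMem_addPart hs, ?_, ?_⟩, ?_⟩
    · rw [sum_addPart, Nat.cast_add]
      omega
    · rw [durfee_addPart, numGt_addPart, if_neg (lt_irrefl _)]
      exact numGt_durfee_le c s
    · rw [durfee_addPart, erase_addPart hs]
  · rintro s ⟨hs, h, h'⟩
    have h₁ := addPart_erase hs (durfee_mem h')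
    have h₂ := congrArg Multiset.sum h₁
    rw [sum_addPart] at h₂
    refine ⟨⟨zero_notMem_erase hs, ?_⟩, ?_⟩
    · rw [durfee_erase hs h']
      omega
    · rw [durfee_erase hs h', h₁]

lemma durfee_conj_cons (c : ℕ) (s : Multiset ℕ) :
    durfee (c + 1) (conj ((durfee (c + 1) (conj s) + (c + 1)) ::ₘ s)) =
      durfee (c + 1) (conj s) := by
  refine durfee_conj_eq ?_ fun j hj => ?_
  · rw [numGt_cons, if_neg (lt_irrefl _)]
    exact numGt_durfee_conj_le _ _
  · have := lt_numGt_of_lt_durfee_conj (c := c + 1) (s := s) (k := j) (by omega)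
    rw [numGt_cons]
    omega

lemma durfee_conj_mem {c : ℕ} {s : Multiset ℕ}
    (h : durfee (c + 1) (conj s) < numGt s (durfee (c + 1) (conj s) + c)) :
    durfee (c + 1) (conj s) + (c + 1) ∈ s :=
  mem_of_numGt_lt (k := durfee (c + 1) (conj s) + c)
    (lt_of_le_of_lt (numGt_durfee_conj_le (c + 1) s) h)

lemma durfee_conj_erase {c : ℕ} {s : Multiset ℕ}
    (h : durfee (c + 1) (conj s) < numGt s (durfee (c + 1) (conj s) + c)) :
    durfee (c + 1) (conj (s.erase (durfee (c + 1) (conj s) + (c + 1)))) =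
      durfee (c + 1) (conj s) := by
  have hg := numGt_cons (durfee (c + 1) (conj s) + (c + 1))
    (s.erase (durfee (c + 1) (conj s) + (c + 1)))
  rw [Multiset.cons_erase (durfee_conj_mem h)] at hg
  refine durfee_conj_eq ?_ fun j hj => ?_
  · have := numGt_durfee_conj_le (c + 1) s
    rw [hg, if_neg (lt_irrefl _)] at this
    omega
  · have h₁ := hg (j + (c + 1))
    rw [hj, show j + 1 + c = j + (c + 1) by omega] at h
    split_ifs at h₁ <;> omega

lemma durfeeCount_sub_eq_ncard (c : ℕ) (x : ℤ) : durfeeCount (c + 1) (x - (c + 1)) =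
    {s : Multiset ℕ | 0 ∉ s ∧ (s.sum : ℤ) = x ∧
      ¬ numGt s (durfee (c + 1) s) ≤ durfee (c + 1) s + c}.ncard := by
  rw [← ncard_setOf_conj fun s => (s.sum : ℤ) = x ∧
      ¬ numGt s (durfee (c + 1) s) ≤ durfee (c + 1) s + c, durfeeCount_conj]
  simp only [sum_conj, not_le, lt_numGt_conj]
  rw [ncard_eq_of_inverse (fun s => (durfee (c + 1) (conj s) + (c + 1)) ::ₘ s)
    (fun s => s.erase (durfee (c + 1) (conj s) + (c + 1)))]
  · rintro s ⟨hs, h⟩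
    refine ⟨⟨?_, ?_, ?_⟩, ?_⟩
    · simp [hs]
    · rw [Multiset.sum_cons, Nat.cast_add]
      omega
    · rw [durfee_conj_cons, numGt_cons, if_pos (by omega)]
      rcases h₀ : durfee (c + 1) (conj s) with _ | j
      · omega
      · have := lt_numGt_of_lt_durfee_conj (c := c + 1) (s := s) (k := j) (by omega)
        rw [show j + 1 + c = j + (c + 1) by omega]
        omega
    · rw [durfee_conj_cons, Multiset.erase_cons_head]
  · rintro s ⟨hs, h, h'⟩
    have h₁ := Multiset.cons_erase (durfee_conj_mem h')
    have h₂ := congrArg Multiset.sum h₁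
    rw [Multiset.sum_cons] at h₂
    refine ⟨⟨zero_notMem_erase hs, ?_⟩, ?_⟩
    · rw [durfee_conj_erase h']
      omega
    · rw [durfee_conj_erase h', h₁]

lemma ncard_add_ncard_not {α : Type*} {P Q : α → Prop} (h : {a | P a}.Finite) :
    {a | P a ∧ Q a}.ncard + {a | P a ∧ ¬ Q a}.ncard = {a | P a}.ncard :=
  Set.ncard_inter_add_ncard_sdiff_eq_ncard {a | P a} {a | Q a} h

lemma finite_partitions (x : ℤ) : {s : Multiset ℕ | 0 ∉ s ∧ (s.sum : ℤ) = x}.Finite :=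
  finite_of_sum_le x fun _ hs => ⟨hs.1, hs.2.le⟩

lemma durfeeCount_add (c : ℕ) (x : ℤ) :
    durfeeCount c x + durfeeCount (c + 1) (x - (c + 1)) = pInt x := by
  rw [durfeeCount_eq_ncard, durfeeCount_sub_eq_ncard, pInt,
    ← ncard_add_ncard_not (Q := fun s => numGt s (durfee (c + 1) s) ≤ durfee (c + 1) s + c)
      (finite_partitions x)]
  simp only [and_assoc]
  push_cast
  rfl

lemma numGt_add_replicate_one (s : Multiset ℕ) (m : ℕ) {k : ℕ} (hk : k ≠ 0) :
    numGt (s + Multiset.replicate m 1) k = numGt s k := by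
  have : numGt (Multiset.replicate m 1) k = 0 := by
    rw [← sup_le_iff_numGt, Multiset.sup_le]
    intro b hb
    rw [Multiset.eq_of_mem_replicate hb]
    omega
  rw [numGt_add, this, add_zero]

lemma durfeeCount_add_two_le {c : ℕ} (hc : c ≠ 0) {x y : ℤ} (h : y + 2 ≤ x) :
    durfeeCount (c + 2) y ≤ durfeeCount c x := by
  rw [durfeeCount_conj, durfeeCount_conj]
  have hd : ∀ (b : ℕ), b ≠ 0 → ∀ (k : ℕ) (s : Multiset ℕ),
      durfee b (conj (s + Multiset.replicate k 1)) = durfee b (conj s) := fun b hb k s => by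
    refine eq_of_forall_ge_iff fun i => ?_
    obtain ⟨b, rfl⟩ := Nat.exists_eq_add_one_of_ne_zero hb
    rw [durfee_conj_le_iff, durfee_conj_le_iff, ← add_assoc,
      numGt_add_replicate_one _ _ (Nat.succ_ne_zero _)]
  have hle : ∀ s, durfee c (conj s) ≤ durfee (c + 2) (conj s) + 2 := fun s => by
    rw [durfee_conj_le_iff]
    have := numGt_durfee_conj_le (c + 2) s
    rw [show durfee (c + 2) (conj s) + 2 + c = durfee (c + 2) (conj s) + (c + 2) by omega]
    omega
  have hfin : {s : Multiset ℕ | 0 ∉ s ∧ (s.sum : ℤ) + durfee c (conj s) = x}.Finite :=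
    finite_of_sum_le x fun s hs => ⟨hs.1, by have := hs.2; omega⟩
  refine Nat.cast_le.2 (Set.ncard_le_ncard_of_injOn (fun s => s + Multiset.replicate
    ((x - y).toNat + durfee (c + 2) (conj s) - durfee c (conj s)) 1) ?_ ?_ hfin)
  · rintro s ⟨hs, h'⟩
    have := hle s
    refine ⟨?_, ?_⟩
    · simp [hs, Multiset.mem_replicate]
    · rw [hd c hc]
      simp only [Multiset.sum_add, Multiset.sum_replicate, smul_eq_mul, mul_one]
      omega
  · intro s _ t _ hst
    have h₁ := congrArg (fun u => durfee c (conj u)) hst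
    have h₂ := congrArg (fun u => durfee (c + 2) (conj u)) hst
    simp only [hd c hc, hd (c + 2) (Nat.succ_ne_zero _)] at h₁ h₂
    simp only [h₁, h₂] at hst
    exact add_right_cancel hst

lemma rankGe_eq_ncard {m : ℕ} (hm : m ≠ 0) (x : ℤ) : rankGe m (x + m + 1) =
    {s : Multiset ℕ | 0 ∉ s ∧ (s.sum : ℤ) = x ∧ s.card ≤ s.sup + m + 2}.ncard := by
  have hmem : ∀ s : Multiset ℕ, 0 ∉ s → s.sup ≠ 0 → s.sup ∈ s := fun s hs h₀ => by
    obtain ⟨j, hj⟩ := Nat.exists_eq_add_one_of_ne_zero h₀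
    have h₁ : numGt s (j + 1) = 0 := sup_le_iff_numGt.1 (by omega)
    have h₂ : numGt s j ≠ 0 := fun h => absurd (sup_le_iff_numGt.2 h) (by omega)
    rw [hj]
    exact mem_of_numGt_lt (by omega)
  have hsup : ∀ s : Multiset ℕ, ∀ a, (addPart a s).sup = max a s.sup := fun s a => by
    unfold addPart
    split_ifs with h
    · simp [h]
    · simp
  have herase : ∀ s : Multiset ℕ, ∀ a, (s.erase a).sup ≤ s.sup := fun s a =>
    Multiset.sup_mono (Multiset.subset_of_le (Multiset.erase_le a s))
  rw [rankGe, ncard_eq_of_inverse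
    (fun s => addPart (s.sup - (m + 1)) (conj (s.erase s.sup)))
    (fun s => (s.sup + m + 1) ::ₘ conj (s.erase s.sup))]
  · rintro s ⟨hs, h, h'⟩
    have hs₀ : s.sup ∈ s := hmem s hs (by omega)
    have he := zero_notMem_erase (a := s.sup) hs
    have hcard := Multiset.card_erase_add_one hs₀
    have hsum := congrArg Multiset.sum (Multiset.cons_erase hs₀)
    rw [Multiset.sum_cons] at hsum
    have hsup' : (addPart (s.sup - (m + 1)) (conj (s.erase s.sup))).sup = s.sup - (m + 1) := by
      rw [hsup, sup_conj he]
      omega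
    refine ⟨⟨zero_notMem_addPart (zero_notMem_conj _), ?_, ?_⟩, ?_⟩
    · rw [sum_addPart, sum_conj]
      omega
    · rw [hsup']
      have h₁ : (addPart (s.sup - (m + 1)) (conj (s.erase s.sup))).card ≤
          (conj (s.erase s.sup)).card + 1 := by
        unfold addPart
        split_ifs <;> simp
      rw [card_conj he] at h₁
      have := herase s s.sup
      omega
    · simp only [hsup']
      rw [erase_addPart (zero_notMem_conj _), conj_conj he,
        show s.sup - (m + 1) + m + 1 = s.sup by omega, Multiset.cons_erase hs₀]
  · rintro s ⟨hs, h, h'⟩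
    have he := zero_notMem_erase (a := s.sup) hs
    have hadd := addPart_erase hs (hmem s hs)
    have hsum := congrArg Multiset.sum hadd
    rw [sum_addPart] at hsum
    have hcard : (s.erase s.sup).card ≤ s.sup + m + 1 := by
      rcases eq_or_ne s.sup 0 with h₀ | h₀
      · have := numGt_zero hs
        rw [sup_le_iff_numGt.1 h₀.le] at this
        have := Multiset.card_le_card (Multiset.erase_le s.sup s)
        omega
      · have := Multiset.card_erase_add_one (hmem s hs h₀)
        omega
    have hsup' : ((s.sup + m + 1) ::ₘ conj (s.erase s.sup)).sup = s.sup + m + 1 := by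
      rw [Multiset.sup_cons, sup_conj he]
      exact max_eq_left hcard
    refine ⟨⟨?_, ?_, ?_⟩, ?_⟩
    · simp [zero_notMem_conj]
    · rw [Multiset.sum_cons, sum_conj, Nat.cast_add]
      omega
    · rw [hsup', Multiset.card_cons, card_conj he]
      have := herase s s.sup
      omega
    · simp only [hsup']
      rw [Multiset.erase_cons_head, conj_conj he,
        show s.sup + m + 1 - (m + 1) = s.sup by omega, hadd]

lemma rankGe_add {m : ℕ} (hm : m ≠ 0) (x : ℤ) :
    rankGe m (x + m + 1) + rankGe (m + 3) x = pInt x := by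
  have h₁ : rankGe (m + 3) x =
      {s : Multiset ℕ | 0 ∉ s ∧ (s.sum : ℤ) = x ∧ ¬ s.card ≤ s.sup + m + 2}.ncard := by
    rw [rankGe, ← ncard_setOf_conj]
    congr 2
    ext s
    refine and_congr_right fun hs => ?_
    rw [sum_conj, card_conj hs, sup_conj hs]
    omega
  rw [rankGe_eq_ncard hm, h₁, pInt,
    ← ncard_add_ncard_not (Q := fun s => s.card ≤ s.sup + m + 2) (finite_partitions x)]
  simp only [and_assoc]
  push_cast
  rfl

lemma pInt_eq_zero {x : ℤ} (hx : x < 0) : pInt x = 0 := by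
  rw [pInt, Nat.cast_eq_zero, Set.ncard_eq_zero (finite_partitions x)]
  refine Set.eq_empty_of_forall_notMem ?_
  rintro s ⟨-, h⟩
  omega

lemma rankGe_eq_zero {m : ℕ} {x : ℤ} (hx : x < 0) : rankGe m x = 0 := by
  have : {s : Multiset ℕ | 0 ∉ s ∧ (s.sum : ℤ) = x ∧ s.card + m ≤ s.sup} = ∅ := by
    refine Set.eq_empty_of_forall_notMem ?_
    rintro s ⟨-, h, -⟩
    omega
  rw [rankGe, this, Set.ncard_empty, Nat.cast_zero]

lemma durfeeCount_nonneg (c : ℕ) (x : ℤ) : 0 ≤ durfeeCount c x := Nat.cast_nonneg _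

lemma numGt_cons_one (s : Multiset ℕ) {k : ℕ} (hk : k ≠ 0) : numGt (1 ::ₘ s) k = numGt s k := by
  rw [numGt_cons, if_neg (by omega), add_zero]

lemma numGt_erase_one (s : Multiset ℕ) {k : ℕ} (hk : k ≠ 0) :
    numGt (s.erase 1) k = numGt s k := by
  by_cases h : 1 ∈ s
  · rw [← numGt_cons_one _ hk, Multiset.cons_erase h]
  · rw [Multiset.erase_of_notMem h]

lemma sum_erase_one {s : Multiset ℕ} (h : 1 ∈ s) : (s.erase 1).sum + 1 = s.sum := by
  rw [add_comm, ← Multiset.sum_cons, Multiset.cons_erase h]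

lemma finite_pairs (x : ℤ) :
    {z : Multiset ℕ × ℕ | 0 ∉ z.1 ∧ (z.1.sum : ℤ) + z.2 = x}.Finite := by
  refine ((finite_sum_le x.toNat).prod (Set.finite_Iic x.toNat)).subset ?_
  rintro ⟨s, k⟩ ⟨hs, h⟩
  dsimp only at hs h
  exact ⟨⟨hs, by dsimp only; omega⟩, Set.mem_Iic.2 (by dsimp only; omega)⟩

lemma ncard_ones_eq {θ : ℕ → ℕ} (hθ : Monotone θ) (x : ℤ) :
    {s : Multiset ℕ | 0 ∉ s ∧ (s.sum : ℤ) = x ∧ s.count 1 ≠ 0 ∧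
      numGt s (s.count 1) ≤ θ (s.count 1)}.ncard =
    {z : Multiset ℕ × ℕ | (0 ∉ z.1 ∧ (z.1.sum : ℤ) + z.2 = x ∧ z.2 ≠ 0 ∧
      numGt z.1 z.2 ≤ θ z.2) ∧ ¬ (z.2 ≠ 1 ∧ numGt z.1 (z.2 - 1) ≤ θ (z.2 - 1))}.ncard := by
  have hfin : {z : Multiset ℕ × ℕ | 0 ∉ z.1 ∧ (z.1.sum : ℤ) + z.2 = x ∧ z.2 ≠ 0 ∧
      numGt z.1 z.2 ≤ θ z.2}.Finite :=
    (finite_pairs x).subset fun z hz => ⟨hz.1, hz.2.1⟩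
  have h₁ := ncard_add_ncard_not (Q := fun z => 1 ∈ z.1) hfin
  have h₂ := ncard_add_ncard_not
    (Q := fun z => z.2 ≠ 1 ∧ numGt z.1 (z.2 - 1) ≤ θ (z.2 - 1)) hfin
  have h₃ : {s : Multiset ℕ | 0 ∉ s ∧ (s.sum : ℤ) = x ∧ s.count 1 ≠ 0 ∧
      numGt s (s.count 1) ≤ θ (s.count 1)}.ncard =
      {z : Multiset ℕ × ℕ | (0 ∉ z.1 ∧ (z.1.sum : ℤ) + z.2 = x ∧ z.2 ≠ 0 ∧
      numGt z.1 z.2 ≤ θ z.2) ∧ ¬ 1 ∈ z.1}.ncard := by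
    have hsplit : ∀ s : Multiset ℕ,
        s.filter (· ≠ 1) + Multiset.replicate (s.count 1) 1 = s := fun s => by
      rw [← Multiset.filter_eq', add_comm]
      exact Multiset.filter_add_not _ s
    refine ncard_eq_of_inverse (fun s => (s.filter (· ≠ 1), s.count 1))
      (fun z => z.1 + Multiset.replicate z.2 1) ?_ ?_
    · rintro s ⟨hs, h, h0, hk⟩
      refine ⟨⟨⟨?_, ?_, h0, ?_⟩, ?_⟩, hsplit s⟩
      · simp [hs]
      · have := congrArg Multiset.sum (hsplit s)
        rw [Multiset.sum_add, Multiset.sum_replicate, smul_eq_mul, mul_one] at this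
        dsimp only
        omega
      · dsimp only
        rwa [← numGt_add_replicate_one _ (s.count 1) h0, hsplit]
      · simp
    · rintro ⟨s, k⟩ ⟨⟨hs, h, h0, hk⟩, h1⟩
      dsimp only at hs h h0 hk h1 ⊢
      have hc : (s + Multiset.replicate k 1).count 1 = k := by
        rw [Multiset.count_add, Multiset.count_eq_zero.2 h1, Multiset.count_replicate_self,
          zero_add]
      refine ⟨⟨?_, ?_, ?_, ?_⟩, ?_⟩
      · simp [hs, Multiset.mem_replicate]
      · rw [Multiset.sum_add, Multiset.sum_replicate, smul_eq_mul, mul_one, Nat.cast_add, h]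
      · rwa [hc]
      · rwa [hc, numGt_add_replicate_one _ _ h0]
      · rw [hc]
        refine Prod.ext ?_ rfl
        dsimp only
        rw [Multiset.filter_add, Multiset.filter_eq_self.2, Multiset.filter_eq_nil.2, add_zero]
        · intro a ha
          simp [Multiset.eq_of_mem_replicate ha]
        · rintro a ha rfl
          exact h1 ha
  have h₄ : {z : Multiset ℕ × ℕ | (0 ∉ z.1 ∧ (z.1.sum : ℤ) + z.2 = x ∧ z.2 ≠ 0 ∧
      numGt z.1 z.2 ≤ θ z.2) ∧ 1 ∈ z.1}.ncard =
      {z : Multiset ℕ × ℕ | (0 ∉ z.1 ∧ (z.1.sum : ℤ) + z.2 = x ∧ z.2 ≠ 0 ∧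
      numGt z.1 z.2 ≤ θ z.2) ∧ z.2 ≠ 1 ∧ numGt z.1 (z.2 - 1) ≤ θ (z.2 - 1)}.ncard := by
    refine ncard_eq_of_inverse (fun z => (z.1.erase 1, z.2 + 1))
      (fun z => (1 ::ₘ z.1, z.2 - 1)) ?_ ?_
    · rintro ⟨s, k⟩ ⟨⟨hs, h, h0, hk⟩, h1⟩
      dsimp only at hs h h0 hk h1 ⊢
      have := sum_erase_one h1
      refine ⟨⟨⟨zero_notMem_erase hs, ?_, by omega, ?_⟩, by omega, ?_⟩, ?_⟩
      · dsimp only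
        omega
      · dsimp only
        rw [numGt_erase_one _ (Nat.succ_ne_zero _)]
        exact (numGt_antitone s (Nat.le_succ k)).trans (hk.trans (hθ (Nat.le_succ k)))
      · dsimp only
        rwa [Nat.add_sub_cancel, numGt_erase_one _ h0]
      · rw [Multiset.cons_erase h1, Nat.add_sub_cancel]
    · rintro ⟨s, k⟩ ⟨⟨hs, h, h0, hk⟩, h1, h2⟩
      dsimp only at hs h h0 hk h1 h2 ⊢
      refine ⟨⟨⟨?_, ?_, ?_, ?_⟩, ?_⟩, ?_⟩
      · simp [hs]
      · dsimp only
        rw [Multiset.sum_cons]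
        omega
      · dsimp only
        omega
      · dsimp only
        rwa [numGt_cons_one _ (by omega)]
      · simp
      · rw [Multiset.erase_cons_head, Nat.sub_add_cancel (by omega)]
  omega

lemma ncard_sup_le_eq (c : ℕ) (x : ℤ) :
    {s : Multiset ℕ | 0 ∉ s ∧ (s.sum : ℤ) = x ∧ s.sup ≤ c}.ncard =
      {s : Multiset ℕ | 0 ∉ s ∧ (s.sum : ℤ) = x ∧ durfee c s = 0}.ncard := by
  rw [← ncard_setOf_conj fun s => (s.sum : ℤ) = x ∧ durfee c s = 0]
  simp only [sum_conj, ← Nat.le_zero, durfee_conj_le_iff, zero_add]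
  simp only [Nat.le_zero, sup_le_iff_numGt]

lemma ncard_crank_le (c : ℕ) {x : ℤ} (hx : 2 ≤ x) :
    (({s : Multiset ℕ | 0 ∉ s ∧ (s.sum : ℤ) = x ∧ s.count 1 ≠ 0 ∧
        numGt s (s.count 1) ≤ s.count 1 + c}.ncard +
      {s : Multiset ℕ | (0 ∉ s ∧ (s.sum : ℤ) = x ∧ s.sup ≤ c) ∧ s.count 1 = 0}.ncard : ℕ) : ℤ) =
    durfeeCount c x := by
  have h₁ : {s : Multiset ℕ | (0 ∉ s ∧ (s.sum : ℤ) = x ∧ s.sup ≤ c) ∧ ¬ s.count 1 = 0}.ncard =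
      {s : Multiset ℕ | 0 ∉ s ∧ (s.sum : ℤ) = x - 1 ∧ s.sup ≤ c}.ncard := by
    refine ncard_eq_of_inverse (fun s => s.erase 1) (fun s => 1 ::ₘ s) ?_ ?_
    · rintro s ⟨⟨hs, h, hc⟩, h1⟩
      have h1' : 1 ∈ s := not_not.1 fun h' => h1 (Multiset.count_eq_zero.2 h')
      have := sum_erase_one h1'
      exact ⟨⟨zero_notMem_erase hs, by omega,
        (Multiset.sup_mono (Multiset.subset_of_le (Multiset.erase_le 1 s))).trans hc⟩,
        Multiset.cons_erase h1'⟩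
    · rintro s ⟨hs, h, hc⟩
      refine ⟨⟨⟨?_, ?_, ?_⟩, ?_⟩, Multiset.erase_cons_head _ _⟩
      · simp [hs]
      · rw [Multiset.sum_cons]
        omega
      · rw [Multiset.sup_cons]
        refine max_le (Nat.one_le_iff_ne_zero.2 ?_) hc
        rintro rfl
        have h0 := sup_le_iff_numGt.1 hc
        rw [numGt_zero hs, Multiset.card_eq_zero] at h0
        subst h0
        simp at h
        omega
      · simp
  have h₂ := ncard_add_ncard_not (P := fun s : Multiset ℕ => 0 ∉ s ∧ (s.sum : ℤ) = x ∧ s.sup ≤ c)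
    (Q := fun s => s.count 1 = 0) (finite_of_sum_le x fun s hs => ⟨hs.1, hs.2.1.le⟩)
  have h₃ := ncard_add_ncard_not
    (P := fun s : Multiset ℕ => 0 ∉ s ∧ (s.sum : ℤ) + durfee c s = x)
    (Q := fun s => durfee c s = 0) (finite_of_sum_le x fun s hs => ⟨hs.1, by have := hs.2; omega⟩)
  have h₄ : {s : Multiset ℕ | (0 ∉ s ∧ (s.sum : ℤ) + durfee c s = x) ∧ durfee c s = 0} =
      {s : Multiset ℕ | 0 ∉ s ∧ (s.sum : ℤ) = x ∧ durfee c s = 0} := by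
    ext s
    simp only [Set.mem_ofPred_eq, and_assoc]
    refine and_congr_right fun _ => and_congr_left fun h => ?_
    rw [h, Nat.cast_zero, add_zero]
  have hfin : {z : Multiset ℕ × ℕ | (0 ∉ z.1 ∧ (z.1.sum : ℤ) + z.2 = x ∧ z.2 ≠ 0 ∧
      numGt z.1 z.2 ≤ z.2 + c) ∧ ¬ (z.2 ≠ 1 ∧ numGt z.1 (z.2 - 1) ≤ z.2 - 1 + c)}.Finite :=
    (finite_pairs x).subset fun z hz => ⟨hz.1.1, hz.1.2.1⟩
  have h₅ := ncard_add_ncard_not (Q := fun z => durfee c z.1 = z.2) hfin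
  have h₆ : {z : Multiset ℕ × ℕ | ((0 ∉ z.1 ∧ (z.1.sum : ℤ) + z.2 = x ∧ z.2 ≠ 0 ∧
      numGt z.1 z.2 ≤ z.2 + c) ∧ ¬ (z.2 ≠ 1 ∧ numGt z.1 (z.2 - 1) ≤ z.2 - 1 + c)) ∧
      durfee c z.1 = z.2}.ncard =
      {s : Multiset ℕ | (0 ∉ s ∧ (s.sum : ℤ) + durfee c s = x) ∧ ¬ durfee c s = 0}.ncard := by
    refine ncard_eq_of_inverse (fun z => z.1) (fun s => (s, durfee c s)) ?_ ?_
    · rintro ⟨s, k⟩ ⟨⟨⟨hs, h, h0, hk⟩, h1⟩, h2⟩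
      dsimp only at hs h h0 hk h1 h2 ⊢
      subst h2
      exact ⟨⟨⟨hs, h⟩, h0⟩, rfl⟩
    · rintro s ⟨⟨hs, h⟩, h0⟩
      refine ⟨⟨⟨⟨hs, h, h0, numGt_durfee_le c s⟩, ?_⟩, rfl⟩, rfl⟩
      rintro ⟨-, h'⟩
      have := durfee_le_iff.2 h'
      dsimp only at this
      omega
  have h₇ : {z : Multiset ℕ × ℕ | ((0 ∉ z.1 ∧ (z.1.sum : ℤ) + z.2 = x ∧ z.2 ≠ 0 ∧
      numGt z.1 z.2 ≤ z.2 + c) ∧ ¬ (z.2 ≠ 1 ∧ numGt z.1 (z.2 - 1) ≤ z.2 - 1 + c)) ∧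
      ¬ durfee c z.1 = z.2}.ncard =
      {s : Multiset ℕ | 0 ∉ s ∧ (s.sum : ℤ) = x - 1 ∧ durfee c s = 0}.ncard := by
    refine ncard_eq_of_inverse (fun z => z.1) (fun s => (s, 1)) ?_ ?_
    · rintro ⟨s, k⟩ ⟨⟨⟨hs, h, h0, hk⟩, h1⟩, h2⟩
      dsimp only at hs h h0 hk h1 h2 ⊢
      rw [← durfee_le_iff] at hk h1
      have hk1 : k = 1 := by omega
      exact ⟨⟨hs, by omega, by omega⟩, by rw [hk1]⟩
    · rintro s ⟨hs, h, h0⟩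
      refine ⟨⟨⟨⟨hs, ?_, one_ne_zero, ?_⟩, ?_⟩, ?_⟩, rfl⟩
      · dsimp only
        omega
      · rw [← durfee_le_iff]
        dsimp only
        omega
      · simp
      · change ¬ durfee c s = 1
        omega
  have h₈ := ncard_sup_le_eq c x
  have h₉ := ncard_sup_le_eq c (x - 1)
  rw [durfeeCount, ncard_ones_eq (θ := fun k => k + c) (fun a b h => Nat.add_le_add_right h c)]
  rw [h₄] at h₃
  omega

lemma ncard_crank_neg (x : ℤ) :
    ({s : Multiset ℕ | 0 ∉ s ∧ (s.sum : ℤ) = x ∧ s.count 1 ≠ 0 ∧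
        numGt s (s.count 1) ≤ s.count 1 - 1}.ncard : ℤ) = durfeeCount 1 (x - 1) := by
  rw [durfeeCount_conj, ncard_ones_eq (θ := fun k => k - 1) (fun a b h => Nat.sub_le_sub_right h 1)]
  refine congrArg _ (ncard_eq_of_inverse (fun z => z.1) (fun s => (s, durfee 1 (conj s) + 1)) ?_ ?_)
  · rintro ⟨s, k⟩ ⟨⟨hs, h, h0, hk⟩, h1⟩
    dsimp only at hs h h0 hk h1 ⊢
    obtain ⟨k, rfl⟩ := Nat.exists_eq_add_one_of_ne_zero h0
    have hd : durfee 1 (conj s) = k := by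
      refine durfee_conj_eq hk fun j hj => ?_
      subst hj
      simp only [Nat.add_sub_cancel] at h1
      omega
    exact ⟨⟨hs, by omega⟩, by rw [hd]⟩
  · rintro s ⟨hs, h⟩
    refine ⟨⟨⟨hs, ?_, Nat.succ_ne_zero _, numGt_durfee_conj_le 1 s⟩, ?_⟩, rfl⟩
    · push_cast [-Nat.cast_multiset_sum]
      omega
    · rintro ⟨h1, h2⟩
      simp only [Nat.add_sub_cancel] at h1 h2
      obtain ⟨j, hj⟩ := Nat.exists_eq_add_one_of_ne_zero (n := durfee 1 (conj s)) (by omega)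
      have := lt_numGt_of_lt_durfee_conj (c := 1) (k := j) (s := s) (by omega)
      rw [hj] at h2
      omega

/-- The sum `(k + 1) + (k + 2) + ⋯ + (k + i)`. -/
def offset (k : ℕ) : ℕ → ℤ
  | 0 => 0
  | i + 1 => offset k i + k + i + 1

lemma two_mul_offset (k i : ℕ) : 2 * offset k i = i * (2 * k + i + 1) := by
  induction i with
  | zero => simp [offset]
  | succ i ih =>
    rw [offset]
    push_cast
    linarith

lemma durfeeCount_eq_sum (x : ℤ) (k L : ℕ) : durfeeCount (k + 1) (x - offset k 1) =
    ∑ i ∈ Finset.range L, (-1) ^ i * pInt (x - offset k (i + 1)) +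
      (-1) ^ L * durfeeCount (k + L + 1) (x - offset k (L + 1)) := by
  induction L with
  | zero => simp
  | succ L ih =>
    have h := durfeeCount_add (k + L + 1) (x - offset k (L + 1))
    have h' : x - offset k (L + 1) - ((k + L + 1 : ℕ) + 1) = x - offset k (L + 1 + 1) := by
      conv_rhs => rw [offset]
      push_cast
      ring
    rw [h'] at h
    rw [ih, Finset.sum_range_succ, ← h, pow_succ, ← add_assoc k L 1]
    ring

lemma rankGe_eq_sum_add (x : ℤ) {m : ℕ} (hm : m ≠ 0) (L : ℕ) : rankGe m x =
    ∑ i ∈ Finset.range L, (-1) ^ i * pInt (x - offset (m + i) (i + 1)) +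
      (-1) ^ L * rankGe (m + 3 * L) (x - offset (m + L) (L + 1) + (m + 3 * L : ℕ) + 1) := by
  induction L with
  | zero =>
    simp only [offset, Finset.range_zero, Finset.sum_empty, pow_zero, one_mul, zero_add, mul_zero,
      add_zero, Nat.cast_zero]
    congr 1
    ring
  | succ L ih =>
    have h := rankGe_add (m := m + 3 * L) (by omega) (x - offset (m + L) (L + 1))
    have h' : x - offset (m + (L + 1)) (L + 1 + 1) + (m + 3 * (L + 1) : ℕ) + 1 =
        x - offset (m + L) (L + 1) := by
      have h₁ := two_mul_offset (m + (L + 1)) (L + 1 + 1)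
      have h₂ := two_mul_offset (m + L) (L + 1)
      push_cast at h₁ h₂ ⊢
      linarith
    rw [ih, Finset.sum_range_succ, ← h, pow_succ, h', show m + 3 * (L + 1) = m + 3 * L + 3 by ring]
    ring

lemma rankGe_eq_sum (n : ℕ) {m : ℕ} (hm : m ≠ 0) : rankGe m n =
    ∑ i ∈ Finset.range (n + 1), (-1) ^ i * pInt (n - offset (m + i) (i + 1)) := by
  rw [rankGe_eq_sum_add n hm (n + 1), rankGe_eq_zero, mul_zero, add_zero]
  have h₁ := two_mul_offset (m + (n + 1)) (n + 1 + 1)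
  have hm' : (1 : ℤ) ≤ m := by exact_mod_cast Nat.one_le_iff_ne_zero.2 hm
  push_cast at h₁ ⊢
  nlinarith

lemma sum_rankGe (n : ℕ) : ∑ m ∈ Finset.range n, rankGe (m + 1) n =
    ∑ k ∈ Finset.range n, ∑ i ∈ Finset.range (k + 1),
      (-1) ^ i * pInt (n - offset (k + 1) (i + 1)) := by
  simp only [rankGe_eq_sum n (Nat.succ_ne_zero _)]
  rw [Finset.sum_comm]
  have key : ∀ i : ℕ,
      ∑ m ∈ Finset.range n, (-1) ^ i * pInt (n - offset (m + 1 + i) (i + 1)) =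
      ∑ k ∈ Finset.filter (fun k => i ≤ k) (Finset.range n),
        (-1) ^ i * pInt (n - offset (k + 1) (i + 1)) := fun i => by
    have h := Finset.sum_Ico_eq_sum_range
      (fun k => (-1) ^ i * pInt (n - offset (k + 1) (i + 1))) i (n + i)
    rw [Nat.add_sub_cancel] at h
    simp only [show ∀ m, m + 1 + i = i + m + 1 by intro m; ring]
    rw [← h]
    symm
    refine Finset.sum_subset ?_ ?_
    · intro k hk
      simp only [Finset.mem_filter, Finset.mem_range, Finset.mem_Ico] at hk ⊢
      omega
    · intro k hk hk'
      simp only [Finset.mem_filter, Finset.mem_range, Finset.mem_Ico] at hk hk'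
      rw [pInt_eq_zero, mul_zero]
      have h₁ := two_mul_offset (k + 1) (i + 1)
      have h₂ : (n : ℤ) ≤ k := by exact_mod_cast (by omega : n ≤ k)
      push_cast at h₁
      nlinarith
  simp only [key]
  refine Finset.sum_comm' fun i k => ?_
  simp only [Finset.mem_filter, Finset.mem_range]
  omega

lemma alternating_sum_mem_Icc (n : ℕ) : ∀ T : ℕ → ℤ, Antitone T → (∀ k, 0 ≤ T k) →
    0 ≤ ∑ k ∈ Finset.range n, (-1) ^ k * T k ∧ ∑ k ∈ Finset.range n, (-1) ^ k * T k ≤ T 0 := by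
  induction n with
  | zero => intro T _ h; simpa using h 0
  | succ n ih =>
    intro T hT h
    have h' := ih (fun k => T (k + 1)) (fun a b hab => hT (Nat.succ_le_succ hab)) fun k => h _
    have h₀ := hT (Nat.le_succ 0)
    rw [Finset.sum_range_succ']
    simp only [pow_succ, mul_neg, mul_one, neg_mul, Finset.sum_neg_distrib, pow_zero, one_mul]
    simp only [zero_add, Nat.succ_eq_add_one] at h' h₀
    constructor <;> linarith [h'.1, h'.2]

lemma sum_durfeeCount_le_sum_rankGe (n : ℕ) :
    ∑ k ∈ Finset.range n, durfeeCount (k + 2) (n - (k + 2)) ≤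
      ∑ m ∈ Finset.range n, rankGe (m + 1) n := by
  have h : ∀ k : ℕ, durfeeCount (k + 2) (n - (k + 2)) =
      ∑ i ∈ Finset.range (k + 1), (-1) ^ i * pInt (n - offset (k + 1) (i + 1)) -
        (-1) ^ k * durfeeCount (2 * k + 3) (n - offset (k + 1) (k + 2)) := fun k => by
    have h₁ := durfeeCount_eq_sum n (k + 1) (k + 1)
    have h₂ : offset (k + 1) 1 = k + 2 := by
      simp only [offset]
      push_cast
      ring
    rw [h₂, show k + 1 + (k + 1) + 1 = 2 * k + 3 by ring, pow_succ] at h₁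
    rw [h₁]
    ring
  have hT := alternating_sum_mem_Icc n
    (fun k => durfeeCount (2 * k + 3) (n - offset (k + 1) (k + 2)))
    (antitone_nat_of_succ_le fun k => ?_) fun k => durfeeCount_nonneg _ _
  · simp only [h, Finset.sum_sub_distrib, sum_rankGe]
    linarith [hT.1]
  · refine durfeeCount_add_two_le (c := 2 * k + 3) (Nat.succ_ne_zero _) ?_
    have h₁ := two_mul_offset (k + 1) (k + 2)
    have h₂ := two_mul_offset (k + 1 + 1) (k + 1 + 2)
    push_cast at h₁ h₂
    nlinarith

lemma part_one {n : ℕ} (l : n.Partition) : part l 1 = l.parts.sup := by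
  have key : ∀ L : List ℕ, L.Pairwise (· ≥ ·) → L.getD 0 0 = (L : Multiset ℕ).sup := by
    intro L hL
    rcases L with _ | ⟨a, t⟩
    · rfl
    · rw [List.getD_cons_zero, ← Multiset.cons_coe, Multiset.sup_cons]
      refine (max_eq_left (Multiset.sup_le.2 fun b hb => ?_)).symm
      exact (List.pairwise_cons.1 hL).1 b (Multiset.mem_coe.1 hb)
  rw [part, key, Multiset.coe_reverse, Multiset.sort_eq]
  exact List.pairwise_reverse.2 (Multiset.pairwise_sort _ _)

lemma crank_eq {n : ℕ} (l : n.Partition) : crank l =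
    if l.parts.count 1 = 0 then (l.parts.sup : ℤ)
    else (numGt l.parts (l.parts.count 1) : ℤ) - (l.parts.count 1 : ℤ) := by
  rw [crank, part_one, ← Multiset.countP_eq_card_filter]
  rfl

lemma card_partition_eq_ncard (n : ℕ) (Q : Multiset ℕ → Prop) :
    Nat.card {l : n.Partition // Q l.parts} =
      {s : Multiset ℕ | 0 ∉ s ∧ (s.sum : ℤ) = n ∧ Q s}.ncard := by
  refine Nat.card_congr ⟨fun l => ⟨l.1.parts, fun h => (l.1.parts_pos h).ne' rfl,
    congrArg _ l.1.parts_sum, l.2⟩, fun s => ⟨⟨s.1, fun {i} hi => Nat.pos_of_ne_zero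
      fun h => s.2.1 (h ▸ hi), Nat.cast_injective s.2.2.1⟩, s.2.2.2⟩, fun l => rfl, fun s => rfl⟩

lemma card_crank_le {n : ℕ} (hn : 1 < n) (c : ℕ) :
    (Nat.card {l : n.Partition // crank l ≤ c} : ℤ) = durfeeCount c n := by
  have h : ∀ l : n.Partition, crank l ≤ c ↔
      (l.parts.count 1 ≠ 0 ∧ numGt l.parts (l.parts.count 1) ≤ l.parts.count 1 + c) ∨
        (l.parts.sup ≤ c ∧ l.parts.count 1 = 0) := fun l => by
    rw [crank_eq]
    split_ifs with h <;> omega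
  simp only [h]
  rw [card_partition_eq_ncard n fun s => (s.count 1 ≠ 0 ∧ numGt s (s.count 1) ≤ s.count 1 + c) ∨
        (s.sup ≤ c ∧ s.count 1 = 0), ← ncard_crank_le c (by exact_mod_cast hn),
    ← ncard_add_ncard_not (Q := fun s => s.count 1 ≠ 0)
      (finite_of_sum_le n fun s hs => ⟨hs.1, hs.2.1.le⟩)]
  congr 3 <;>
  · congr 1
    ext s
    tauto

lemma card_crank_neg (n : ℕ) :
    (Nat.card {l : n.Partition // crank l ≤ -1} : ℤ) = durfeeCount 1 (n - 1) := by
  have h : ∀ l : n.Partition, crank l ≤ -1 ↔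
      (l.parts.count 1 ≠ 0 ∧ numGt l.parts (l.parts.count 1) ≤ l.parts.count 1 - 1) := fun l => by
    rw [crank_eq]
    split_ifs with h <;> omega
  simp only [h]
  rw [card_partition_eq_ncard n fun s => s.count 1 ≠ 0 ∧ numGt s (s.count 1) ≤ s.count 1 - 1,
    ← ncard_crank_neg]

lemma card_rank_ge (n m : ℕ) :
    (Nat.card {l : n.Partition // (m : ℤ) ≤ rank l} : ℤ) = rankGe m n := by
  have h : ∀ l : n.Partition, (m : ℤ) ≤ rank l ↔ l.parts.card + m ≤ l.parts.sup := fun l => by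
    rw [rank, part_one]
    omega
  simp only [h]
  rw [card_partition_eq_ncard n fun s => s.card + m ≤ s.sup, rankGe]

lemma p_eq_pInt (n : ℕ) : (p n : ℤ) = pInt n := by
  have h := card_partition_eq_ncard n fun _ => True
  rw [Nat.card_congr (Equiv.subtypeUnivEquiv fun _ => trivial)] at h
  simp only [and_true] at h
  rw [p, h, pInt]

lemma card_add_card_not {n : ℕ} (Q : n.Partition → Prop) :
    Nat.card {l : n.Partition // Q l} + Nat.card {l : n.Partition // ¬ Q l} = p n := by
  classical
  rw [p, ← Nat.card_sum, Nat.card_congr (Equiv.sumCompl Q)]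

lemma card_crank_ge {n : ℕ} (hn : 1 < n) (c : ℕ) :
    (Nat.card {l : n.Partition // (c : ℤ) + 1 ≤ crank l} : ℤ) =
      durfeeCount (c + 1) (n - (c + 1)) := by
  have h₁ := card_add_card_not fun l : n.Partition => crank l ≤ c
  have h₂ := durfeeCount_add c n
  have h₃ := card_crank_le hn c
  have h₄ := p_eq_pInt n
  simp only [not_le, ← Int.add_one_le_iff] at h₁
  omega

lemma sum_mul_card_eq {α : Type*} [Finite α] (F : α → ℤ) (n : ℕ) (hF : ∀ a, F a ≤ n) :
    ∑ m ∈ Finset.Icc (0 : ℤ) n, m * (Nat.card {a // F a = m} : ℤ) =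
      ∑ j ∈ Finset.range n, (Nat.card {a // (j : ℤ) + 1 ≤ F a} : ℤ) := by
  classical
  have := Fintype.ofFinite α
  simp only [Nat.card_eq_fintype_card, Fintype.card_subtype, Finset.card_filter, Nat.cast_sum,
    Finset.mul_sum]
  rw [Finset.sum_comm, Finset.sum_comm (s := Finset.range n)]
  refine Finset.sum_congr rfl fun a _ => ?_
  have hj : Finset.filter (fun j : ℕ => (j : ℤ) + 1 ≤ F a) (Finset.range n) =
      Finset.range (F a).toNat := by
    ext j
    have := hF a
    simp only [Finset.mem_filter, Finset.mem_range]
    omega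
  rw [← Nat.cast_sum, ← Finset.card_filter, hj, Finset.card_range]
  push_cast
  simp only [mul_ite, mul_one, mul_zero, Finset.sum_ite_eq, Finset.mem_Icc, hF a, and_true]
  split_ifs <;> omega

lemma sup_le_sum {n : ℕ} (l : n.Partition) : l.parts.sup ≤ n :=
  Multiset.sup_le.2 fun _ hb => l.parts_sum ▸ Multiset.le_sum_of_mem hb

lemma rank_le {n : ℕ} (l : n.Partition) : rank l ≤ n := by
  have := sup_le_sum l
  rw [rank, part_one]
  omega

lemma crank_le {n : ℕ} (l : n.Partition) : crank l ≤ n := by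
  have h₁ := sup_le_sum l
  have h₂ : l.parts.card ≤ n := by
    rw [← sup_conj (fun h => (l.parts_pos h).ne' rfl)]
    exact Multiset.sup_le.2 fun b hb =>
      (Multiset.le_sum_of_mem hb).trans_eq (by rw [sum_conj, l.parts_sum])
  have h₃ := Multiset.card_le_card (Multiset.filter_le (l.parts.count 1 < ·) l.parts)
  rw [crank, part_one]
  split_ifs <;> omega

lemma ospt_le_card_crank_pos {n : ℕ} (hn : 1 < n) :
    ospt n ≤ Nat.card {l : n.Partition // 1 ≤ crank l} := by
  have h₁ : ∀ m, M m n = Nat.card {l : n.Partition // crank l = m} := fun m => if_neg hn.ne'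
  have h₂ := sum_durfeeCount_le_sum_rankGe n
  have h₃ := durfeeCount_nonneg (n + 1) (n - (n + 1))
  have h₄ := card_crank_ge hn 0
  have h₅ := Finset.sum_range_succ (fun k : ℕ => durfeeCount (k + 1) (n - (k + 1))) n
  rw [Finset.sum_range_succ'] at h₅
  simp only [Nat.cast_add, Nat.cast_one, Nat.cast_zero, zero_add, add_assoc] at h₄ h₅
  simp only [ospt, h₁, N, sum_mul_card_eq crank n crank_le, sum_mul_card_eq rank n rank_le,
    card_crank_ge hn]
  simp only [← Nat.cast_succ, card_rank_ge, Nat.succ_eq_add_one]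
  push_cast
  norm_num at h₂ h₃ h₄ h₅ ⊢
  linarith

lemma two_mul_card_crank_pos {n : ℕ} (hn : 1 < n) :
    2 * (Nat.card {l : n.Partition // 1 ≤ crank l} : ℤ) = p n - M 0 n := by
  have h₁ := card_crank_ge hn 0
  have h₂ := card_crank_neg n
  have h₃ := card_add_card_not fun l : n.Partition => 1 ≤ crank l
  have h₄ : Nat.card {l : n.Partition // crank l ≤ -1} +
      Nat.card {l : n.Partition // crank l = 0} = Nat.card {l : n.Partition // ¬ 1 ≤ crank l} := by
    classical
    simp only [Nat.card_eq_fintype_card]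
    rw [← Fintype.card_subtype_or_disjoint]
    · refine Fintype.card_congr (Equiv.subtypeEquivRight fun l => ?_)
      omega
    · rw [Pi.disjoint_iff]
      intro l
      simp only [Prop.disjoint_iff]
      omega
  rw [M, if_neg hn.ne']
  simp only [Nat.cast_zero, zero_add] at h₁
  omega

end RankCrank

open RankCrank in
/-- For every `n > 1`, `ospt n ≤ p(n)/2 - M(0,n)/2`. -/
theorem ospt_le (n : ℕ) (hn : 1 < n) :
    (ospt n : ℚ) ≤ (p n : ℚ) / 2 - (M 0 n : ℚ) / 2 := by
  have h : 2 * ospt n ≤ p n - M 0 n :=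
    two_mul_card_crank_pos hn ▸ mul_le_mul_of_nonneg_left (ospt_le_card_crank_pos hn) zero_le_two
  have h' : (2 * ospt n : ℚ) ≤ p n - M 0 n := by exact_mod_cast h
  linarith
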